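/- arXiv:1807.08905 — 6 statements merged into one kernel-verified Lean document; each statement's English description precedes it below -/
import Mathlib

section
/- Let K ≥ 1, let T be a K×K Hermitian positive definite complex matrix, let α ∈ ℂ^K with α ≠ 0, let φ : Fin K → ℝ with φₖ ≥ 0 for all k, let ϑ ≥ 0, let P : Fin K → ℝ with Pₖ > 0 for all k, and let ϖ > 0 and ϱ > 0. Define ω := (Σₖ φₖ·Pₖ + ϑ·ϖ²)/ϱ and Z := diag(φ) + (ϑ + ω)·T − α·αᴴ, where diag(φ) is the diagonal matrix with diagonal entries φₖ and α·αᴴ has entries αᵢ·conj(αⱼ). If Z is positive semidefinite and X is a K×K complex matrix with X ≠ 0 and Z·X = 0, then the rank of X equals 1. -/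
open Matrix BigOperators
open scoped ComplexOrder

/-- Deterministic content of Proposition 1: the PSD dual slack matrix `Z`
from the KKT conditions annihilates only rank-one primal matrices. -/
theorem stmt_4 (K : ℕ) (hK : 1 ≤ K) (T : Matrix (Fin K) (Fin K) ℂ)
    (hT : T.PosDef) (α : Fin K → ℂ) (hα : α ≠ 0)
    (φ : Fin K → ℝ) (hφ : ∀ k, 0 ≤ φ k) (ϑ : ℝ) (hϑ : 0 ≤ ϑ)
    (P : Fin K → ℝ) (hP : ∀ k, 0 < P k) (ϖ ϱ : ℝ) (hϖ : 0 < ϖ) (hϱ : 0 < ϱ)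
    (ω : ℝ) (hω : ω = ((∑ k, φ k * P k) + ϑ * ϖ ^ 2) / ϱ)
    (Z : Matrix (Fin K) (Fin K) ℂ)
    (hZ : Z = Matrix.diagonal (fun k => (φ k : ℂ)) + ((ϑ + ω : ℝ) : ℂ) • T -
      Matrix.vecMulVec α (star α))
    (hZpsd : Z.PosSemidef) (X : Matrix (Fin K) (Fin K) ℂ) (hX : X ≠ 0)
    (hZX : Z * X = 0) :
    X.rank = 1 := by
  have hsum : 0 ≤ ∑ k, φ k * P k :=
    Finset.sum_nonneg fun k _ => mul_nonneg (hφ k) (hP k).le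
  have hω0 : 0 ≤ ω := by rw [hω]; positivity
  have hc : 0 < ϑ + ω := by
    rcases (add_nonneg hϑ hω0).lt_or_eq with h | h
    · exact h
    exfalso
    have h1 : ϑ = 0 := by linarith
    have h2 : ω = 0 := by linarith
    have h3 : ∑ k, φ k * P k = 0 := by
      rw [h2, h1] at hω
      have := hω.symm
      rw [div_eq_zero_iff] at this
      rcases this with h | h
      · simpa using h
      · exact absurd h hϱ.ne'
    have h4 : ∀ k, φ k = 0 := by
      intro k
      have := (Finset.sum_eq_zero_iff_of_nonneg
        (fun k _ => mul_nonneg (hφ k) (hP k).le)).1 h3 k (Finset.mem_univ k)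
      exact (mul_eq_zero.1 this).resolve_right (hP k).ne'
    apply hα
    funext k
    have h5 : 0 ≤ Z k k := hZpsd.diag_nonneg
    have h6 : Z k k = -(α k * star (α k)) := by
      rw [hZ, ← h]
      simp [h4, Matrix.vecMulVec_apply]
    rw [h6] at h5
    have h7 : 0 ≤ α k * star (α k) := mul_star_self_nonneg _
    have h8 : α k * star (α k) = 0 := le_antisymm (neg_nonneg.1 h5) h7
    simpa using h8
  have hcC : (0 : ℂ) < ((ϑ + ω : ℝ) : ℂ) := by exact_mod_cast hc
  have hD : (Matrix.diagonal (fun k => (φ k : ℂ)) + ((ϑ + ω : ℝ) : ℂ) • T).PosDef := by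
    refine Matrix.PosDef.posSemidef_add ?_ (hT.smul hcC)
    exact Matrix.PosSemidef.diagonal fun k => by
      simpa using hφ k
  generalize Matrix.diagonal (fun k => (φ k : ℂ)) + ((ϑ + ω : ℝ) : ℂ) • T = D at hD hZ
  have hu : IsUnit D.det := (Matrix.isUnit_iff_isUnit_det D).1 hD.isUnit
  have hDX : D * X = Matrix.vecMulVec α (star α) * X := by
    rw [hZ, Matrix.sub_mul] at hZX
    exact sub_eq_zero.1 hZX
  have hXe : X = D⁻¹ * (Matrix.vecMulVec α (star α) * X) := by
    rw [← hDX, Matrix.nonsing_inv_mul_cancel_left _ _ hu]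
  have hle : X.rank ≤ 1 := by
    rw [hXe]
    exact (Matrix.rank_mul_le_right _ _).trans
      ((Matrix.rank_mul_le_left _ _).trans (Matrix.rank_vecMulVec_le _ _))
  have hne : X.rank ≠ 0 := by
    intro h
    rw [Matrix.rank, Submodule.finrank_eq_zero, LinearMap.range_eq_bot] at h
    apply hX
    ext i j
    have h2 := congrFun (LinearMap.congr_fun h (Pi.single j 1)) i
    simpa using h2
  omega
end

section
/- Let n ≥ 1 be a natural number, σ > 0, and Λ ≥ 0. Under the product measure ⨂_{i ∈ Fin (2n)} gaussianReal 0 (σ²/2) on ℝ^{2n}, the probability of the event { x : Σᵢ (xᵢ)² ≥ σ²·Λ } equals (1/Γ(n)) · ∫_Λ^∞ t^{n−1}·exp(−t) dt. -/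
open MeasureTheory ProbabilityTheory BigOperators

lemma pi_gaussian_aux (m : ℕ) (v : NNReal) (hv : v ≠ 0) :
    (Measure.pi fun _ : Fin m => gaussianReal 0 v) =
      (volume : Measure (Fin m → ℝ)).withDensity
        (fun x => ENNReal.ofReal (∏ i, gaussianPDFReal 0 v (x i))) := by
  have hint : Integrable (fun x : Fin m → ℝ => ∏ i, gaussianPDFReal 0 v (x i)) :=
    Integrable.fintype_prod (μ := fun _ => volume)
      (f := fun _ : Fin m => gaussianPDFReal 0 v)
      (fun _ => integrable_gaussianPDFReal 0 v)
  apply Measure.pi_eq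
  intro s hs
  rw [withDensity_apply _ (MeasurableSet.univ_pi hs),
    ← ofReal_integral_eq_lintegral_ofReal hint.restrict
      (ae_of_all _ fun x => Finset.prod_nonneg fun i _ => gaussianPDFReal_nonneg _ _ _),
    volume_pi, Measure.restrict_pi_pi,
    integral_fintype_prod_eq_prod (fun _ : Fin m => gaussianPDFReal 0 v),
    ENNReal.ofReal_prod_of_nonneg
      (fun i _ => integral_nonneg fun x => gaussianPDFReal_nonneg _ _ _)]
  exact Finset.prod_congr rfl fun i _ => (gaussianReal_apply_eq_integral 0 hv (s i)).symm

lemma radial_aux (n : ℕ) (hn : 1 ≤ n) (σ Λ : ℝ) (hσ : 0 < σ) (hΛ : 0 ≤ Λ) (C : ℝ) :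
    ∫ y in Set.Ioi (0:ℝ), y ^ (2 * n - 1) •
        (if σ ^ 2 * Λ ≤ y ^ 2 then C * Real.exp (-y ^ 2 / σ ^ 2) else 0) =
      C * σ ^ (2 * n) / 2 * ∫ t in Set.Ioi Λ, t ^ (n - 1) * Real.exp (-t) := by
  have h1 := integral_comp_mul_left_Ioi' (fun y : ℝ => y ^ (2 * n - 1) •
        (if σ ^ 2 * Λ ≤ y ^ 2 then C * Real.exp (-y ^ 2 / σ ^ 2) else 0)) 0 hσ
  rw [mul_zero] at h1
  have h2 := integral_comp_rpow_Ioi_of_pos (p := 2) two_pos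
    (g := fun t : ℝ => (Set.Ici Λ).indicator (fun t => t ^ (n - 1) * Real.exp (-t)) t)
  have h3 : ∫ t in Set.Ioi Λ, t ^ (n - 1) * Real.exp (-t) =
      ∫ t in Set.Ioi (0:ℝ), (Set.Ici Λ).indicator (fun t => t ^ (n - 1) * Real.exp (-t)) t := by
    rw [← integral_Ici_eq_integral_Ioi, ← integral_Ici_eq_integral_Ioi,
      setIntegral_indicator measurableSet_Ici, Set.inter_eq_right.mpr (Set.Ici_subset_Ici.mpr hΛ)]
  rw [h3, ← h2, ← h1, smul_eq_mul, ← integral_const_mul, ← integral_const_mul]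
  apply setIntegral_congr_fun measurableSet_Ioi
  intro y hy
  have hy : 0 < y := hy
  obtain ⟨k, rfl⟩ : ∃ k, n = k + 1 := ⟨n - 1, by omega⟩
  have e : 2 * (k + 1) - 1 = 2 * k + 1 := by omega
  have hiff : σ ^ 2 * Λ ≤ (σ * y) ^ 2 ↔ Λ ≤ y ^ 2 := by
    rw [mul_pow]; exact mul_le_mul_iff_right₀ (by positivity)
  have e2 : -(σ * y) ^ 2 / σ ^ 2 = - y ^ 2 := by field_simp
  have e3 : y ^ (2:ℝ) = y ^ 2 := by norm_cast
  have e4 : y ^ ((2:ℝ) - 1) = y := by norm_num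
  simp only [smul_eq_mul, e, e2, e3, e4, hiff, Set.indicator, Set.mem_Ici, Nat.add_sub_cancel]
  split_ifs
  · ring
  · simp

set_option maxHeartbeats 1000000 in
theorem stmt_6 (n : ℕ) (hn : 1 ≤ n) (σ Λ : ℝ) (hσ : 0 < σ) (hΛ : 0 ≤ Λ) :
    (Measure.pi fun _ : Fin (2 * n) => gaussianReal 0 ((σ ^ 2 / 2).toNNReal))
        {x | σ ^ 2 * Λ ≤ ∑ i, (x i) ^ 2} =
      ENNReal.ofReal ((1 / Real.Gamma n) *
        ∫ t in Set.Ioi Λ, t ^ (n - 1) * Real.exp (-t)) := by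
  have hv : (σ ^ 2 / 2).toNNReal ≠ 0 := by
    rw [Ne, Real.toNNReal_eq_zero, not_le]; positivity
  have hvc : (((σ ^ 2 / 2).toNNReal : NNReal) : ℝ) = σ ^ 2 / 2 :=
    Real.coe_toNNReal _ (by positivity)
  have hms : MeasurableSet {x : Fin (2 * n) → ℝ | σ ^ 2 * Λ ≤ ∑ i, (x i) ^ 2} :=
    measurableSet_le (by fun_prop) (by fun_prop)
  have hint : Integrable (fun x : Fin (2 * n) → ℝ =>
      ∏ i, gaussianPDFReal 0 ((σ ^ 2 / 2).toNNReal) (x i)) :=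
    Integrable.fintype_prod (μ := fun _ => volume)
      (f := fun _ : Fin (2 * n) => gaussianPDFReal 0 ((σ ^ 2 / 2).toNNReal))
      (fun _ => integrable_gaussianPDFReal 0 _)
  rw [pi_gaussian_aux _ _ hv, withDensity_apply _ hms,
    ← ofReal_integral_eq_lintegral_ofReal hint.restrict
      (ae_of_all _ fun x => Finset.prod_nonneg fun i _ => gaussianPDFReal_nonneg _ _ _)]
  congr 1
  rw [← integral_indicator hms]
  set C : ℝ := ((Real.pi * σ ^ 2) ^ n)⁻¹ with hC
  have key : ∀ x : EuclideanSpace ℝ (Fin (2 * n)),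
      Set.indicator {x : Fin (2 * n) → ℝ | σ ^ 2 * Λ ≤ ∑ i, (x i) ^ 2}
        (fun x => ∏ i, gaussianPDFReal 0 ((σ ^ 2 / 2).toNNReal) (x i)) (WithLp.ofLp x) =
      (fun y : ℝ => if σ ^ 2 * Λ ≤ y ^ 2 then C * Real.exp (-y ^ 2 / σ ^ 2) else 0) ‖x‖ := by
    intro x
    have hp : ∏ i, gaussianPDFReal 0 ((σ ^ 2 / 2).toNNReal) (x i) =
        C * Real.exp (-(∑ i, (x i) ^ 2) / σ ^ 2) := by
      simp only [gaussianPDFReal, hvc, Finset.prod_mul_distrib, ← Real.exp_sum, sub_zero]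
      congr 1
      · rw [Finset.prod_const, Finset.card_univ, Fintype.card_fin, pow_mul, inv_pow,
          Real.sq_sqrt (by positivity), hC, inv_pow]
        congr 2; ring
      · congr 1
        rw [← Finset.sum_neg_distrib, Finset.sum_div]
        refine Finset.sum_congr rfl fun i _ => ?_
        congr 1; ring
    simp only [Set.indicator, Set.mem_setOf_eq, EuclideanSpace.real_norm_sq_eq, hp]
  rw [← (PiLp.volume_preserving_ofLp (Fin (2 * n))).integral_comp
    (MeasurableEquiv.toLp 2 (Fin (2 * n) → ℝ)).symm.measurableEmbedding]
  simp_rw [key]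
  haveI : Nonempty (Fin (2 * n)) := ⟨⟨0, by omega⟩⟩
  haveI : Nontrivial (EuclideanSpace ℝ (Fin (2 * n))) := inferInstance
  rw [integral_fun_norm_addHaar volume
      (fun y : ℝ => if σ ^ 2 * Λ ≤ y ^ 2 then C * Real.exp (-y ^ 2 / σ ^ 2) else 0),
    finrank_euclideanSpace, Fintype.card_fin, radial_aux n hn σ Λ hσ hΛ C,
    Measure.real, EuclideanSpace.volume_ball, Fintype.card_fin]
  have hG : Real.Gamma ((n:ℝ) + 1) = n * Real.Gamma n :=
    Real.Gamma_add_one (by positivity)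
  have hG0 : 0 < Real.Gamma n := Real.Gamma_pos_of_pos (by positivity)
  have hc : ((2 * n : ℕ) : ℝ) / 2 + 1 = n + 1 := by push_cast; ring
  have hn0 : (0:ℝ) < n := by positivity
  rw [hc, hG, ENNReal.ofReal_one, one_pow, one_mul, ENNReal.toReal_ofReal (by positivity),
    pow_mul, Real.sq_sqrt Real.pi_pos.le, hC, nsmul_eq_mul, smul_eq_mul, mul_pow, ← pow_mul]
  push_cast
  field_simp
end

section
/- Let n ≥ 1 be a natural number, σ > 0, μ : Fin (2n) → ℝ, and E ≥ 0, and set m := Σᵢ (μᵢ)². Under the product measure ⨂_{i ∈ Fin (2n)} gaussianReal (μᵢ) (σ²/2) on ℝ^{2n}, the probability of the event { x : Σᵢ (xᵢ)² > E } equals 1 − exp(−m/σ²) · Σ_{j=0}^∞ ( (m/σ²)^j / j! ) · ( ∫_0^{E/σ²} t^{n+j−1}·exp(−t) dt ) / Γ(n + j). -/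
open MeasureTheory ProbabilityTheory BigOperators
open Set Filter Topology

lemma aux_intble (z : ℂ) (hz : 0 < z.re) (k : ℕ) :
    IntegrableOn (fun t : ℝ => (t : ℂ) ^ k * Complex.exp (-(z * t))) (Ioi 0) := by
  have h := integrableOn_rpow_mul_exp_neg_mul_rpow (s := k) (p := 1) (b := z.re)
    (by have : (0:ℝ) ≤ k := by positivity
        linarith) one_pos hz
  refine Integrable.mono' h (by fun_prop) ?_
  refine (ae_restrict_iff' measurableSet_Ioi).mpr (ae_of_all _ fun t ht => ?_)
  have ht' : (0:ℝ) < t := ht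
  simp [Complex.norm_exp, abs_of_pos ht']

lemma aux_gamma (z : ℂ) (hz : 0 < z.re) (k : ℕ) :
    ∫ t in Ioi (0:ℝ), (t : ℂ) ^ k * Complex.exp (-(z * t)) = (k.factorial : ℂ) / z ^ (k + 1) := by
  have hz0 : z ≠ 0 := by rintro rfl; simp at hz
  have lim : ∀ k : ℕ, Tendsto (fun t : ℝ => -((t : ℂ) ^ k * Complex.exp (-(z * t))) / z) atTop (𝓝 0) := by
    intro k
    rw [tendsto_zero_iff_norm_tendsto_zero]
    have h := (tendsto_rpow_mul_exp_neg_mul_atTop_nhds_zero k z.re hz).div_const ‖z‖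
    rw [zero_div] at h
    refine h.congr' ?_
    filter_upwards [eventually_gt_atTop 0] with t ht
    simp [Complex.norm_exp, abs_of_pos ht]
  induction k with
  | zero =>
    have := integral_Ioi_of_hasDerivAt_of_tendsto' (a := (0:ℝ))
      (f := fun t : ℝ => -((t : ℂ) ^ 0 * Complex.exp (-(z * t))) / z)
      (f' := fun t : ℝ => (t : ℂ) ^ 0 * Complex.exp (-(z * t))) (m := 0) ?_ (aux_intble z hz 0) (lim 0)
    · rw [this]; simp [div_eq_mul_inv]
    · intro x _
      have h1 : HasDerivAt (fun t : ℝ => -(z * (t:ℂ))) (-(z * 1)) x :=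
        ((hasDerivAt_id x).ofReal_comp.const_mul z).neg
      have h2 := (h1.cexp.neg.div_const z)
      convert! h2 using 1
      · ext t; simp
      · field_simp
  | succ k ih =>
    have i1 := aux_intble z hz (k+1)
    have i2 := (aux_intble z hz k).const_mul ((k+1 : ℂ) / z)
    have := integral_Ioi_of_hasDerivAt_of_tendsto' (a := (0:ℝ))
      (f := fun t : ℝ => -((t : ℂ) ^ (k+1) * Complex.exp (-(z * t))) / z)
      (f' := fun t : ℝ => (t : ℂ) ^ (k+1) * Complex.exp (-(z * t)) -
        ((k+1 : ℂ) / z) * ((t : ℂ) ^ k * Complex.exp (-(z * t)))) (m := 0) ?_ (i1.sub i2) (lim (k+1))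
    · rw [integral_sub i1 i2, integral_const_mul, ih] at this
      have h3 : ∫ t in Ioi (0:ℝ), (t : ℂ) ^ (k+1) * Complex.exp (-(z * t)) =
        ((k+1 : ℂ) / z) * (k.factorial / z ^ (k+1)) := by
        simp at this
        exact sub_eq_zero.mp this
      rw [h3, Nat.factorial_succ]; push_cast; field_simp; ring
    · intro x _
      have h1 : HasDerivAt (fun t : ℝ => -(z * (t:ℂ))) (-(z * 1)) x :=
        ((hasDerivAt_id x).ofReal_comp.const_mul z).neg
      have h0 : HasDerivAt (fun t : ℝ => (t:ℂ)^(k+1)) (((k+1 : ℕ):ℂ) * (x:ℂ)^k * 1) x := by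
        simpa using! (hasDerivAt_id x).ofReal_comp.pow (k+1)
      have h2 := ((h0.mul h1.cexp).neg.div_const z)
      convert! h2 using 1
      · push_cast; field_simp; ring

lemma aux_charGamma (N : ℕ) (hN : 1 ≤ N) (t : ℝ) :
    charFun (gammaMeasure N 1) t = ((1 - t * Complex.I)⁻¹) ^ N := by
  obtain ⟨k, rfl⟩ : ∃ k, N = k + 1 := ⟨N - 1, by omega⟩
  have hre : 0 < (1 - t * Complex.I).re := by simp
  rw [charFun_apply_real, gammaMeasure,
    integral_withDensity_eq_integral_toReal_smul (by unfold gammaPDF; fun_prop)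
      (ae_of_all _ fun _ => by simp [gammaPDF])]
  have h := aux_gamma _ hre k
  have : ∀ x : ℝ, (gammaPDF ((k+1 : ℕ) : ℝ) 1 x).toReal • Complex.exp (t * x * Complex.I) =
      (Ici (0:ℝ)).indicator (fun x : ℝ => (k.factorial : ℂ)⁻¹ * ((x:ℂ)^k * Complex.exp (-((1 - t * Complex.I) * x)))) x := by
    intro x
    rw [gammaPDF, ENNReal.toReal_ofReal (gammaPDFReal_nonneg (by positivity) one_pos x)]
    unfold gammaPDFReal
    by_cases hx : 0 ≤ x
    · rw [indicator_of_mem (by exact hx), if_pos hx]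
      have e : (((k+1:ℕ):ℝ) - 1) = (k:ℝ) := by push_cast; ring
      have g : Real.Gamma ((k+1:ℕ):ℝ) = k.factorial := by
        push_cast; exact Real.Gamma_nat_eq_factorial k
      rw [Real.one_rpow, e, g, Real.rpow_natCast, Complex.real_smul]
      push_cast
      rw [mul_assoc, mul_assoc, ← Complex.exp_add, one_div]
      congr 3
      ring
    · rw [indicator_of_notMem (by exact hx), if_neg hx]; simp
  simp_rw [this]
  rw [integral_indicator measurableSet_Ici, integral_Ici_eq_integral_Ioi, integral_const_mul, h, inv_pow]
  have : (k.factorial : ℂ) ≠ 0 := by exact_mod_cast k.factorial_ne_zero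
  field_simp

lemma aux_charGauss (σ : ℝ) (hσ : 0 < σ) (t : ℝ) : ∃ A : ℂ, A ^ 2 = (1 - t * Complex.I)⁻¹ ∧
    ∀ μ : ℝ, ∫ x, Complex.exp (t * (x^2/σ^2 : ℝ) * Complex.I)
        ∂(gaussianReal μ ((σ ^ 2 / 2).toNNReal)) =
      A * Complex.exp ((μ^2/σ^2 : ℝ) * ((1 - t * Complex.I)⁻¹ - 1)) := by
  have hv : ((σ ^ 2 / 2).toNNReal) ≠ 0 := by
    have : 0 < σ^2/2 := by positivity
    simpa using this
  have hw : (1 - t * Complex.I) ≠ 0 := fun h => by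
    have := congrArg Complex.re h; simp at this
  have hs : (σ:ℂ) ≠ 0 := by exact_mod_cast hσ.ne'
  have hp : 0 < Real.pi * σ^2 := by positivity
  refine ⟨((√(Real.pi * σ^2))⁻¹ : ℝ) *
    ((Real.pi : ℂ) / -(-(1 - t * Complex.I)/((σ^2:ℝ):ℂ))) ^ (1/2 : ℂ), ?_, fun μ => ?_⟩
  · have hpi : (Real.pi : ℂ) ≠ 0 := by exact_mod_cast Real.pi_ne_zero
    rw [mul_pow, ← Complex.ofReal_pow, inv_pow, Real.sq_sqrt hp.le, ← Complex.cpow_nat_mul]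
    have h2 : ((2 : ℕ) : ℂ) * (1 / 2 : ℂ) = 1 := by norm_num
    rw [h2, Complex.cpow_one, neg_div, neg_neg]
    push_cast
    field_simp
  rw [integral_gaussianReal_eq_integral_smul hv]
  have key := integral_cexp_quadratic (b := -(1 - t * Complex.I)/((σ^2:ℝ):ℂ)) (by
    rw [Complex.div_ofReal_re]
    have : 0 < σ^2 := by positivity
    simpa [neg_div] using this) (2*μ/σ^2) (-μ^2/σ^2)
  have e : ∀ x : ℝ, gaussianPDFReal μ ((σ ^ 2 / 2).toNNReal) x •
      Complex.exp (t * (x^2/σ^2 : ℝ) * Complex.I) =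
      ((√(Real.pi * σ^2))⁻¹ : ℝ) * Complex.exp (-(1 - t * Complex.I)/((σ^2:ℝ):ℂ) * x^2 + (2*μ/σ^2) * x + (-μ^2/σ^2)) := by
    intro x
    rw [gaussianPDFReal, Real.coe_toNNReal _ (by positivity), Complex.real_smul,
      show 2 * Real.pi * (σ^2/2) = Real.pi * σ^2 by ring, show 2 * (σ^2/2) = σ^2 by ring]
    rw [Complex.ofReal_mul, mul_assoc, Complex.ofReal_exp, ← Complex.exp_add]
    congr 2
    push_cast
    field_simp
    ring
  simp_rw [e]
  rw [integral_const_mul, key, ← mul_assoc]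
  congr 2
  push_cast; field_simp; ring

/-- Poisson mixture of gamma laws. -/
noncomputable def mixMeasure (n : ℕ) (a : ℝ) : Measure ℝ :=
  Measure.sum fun j : ℕ => ENNReal.ofReal (Real.exp (-a) * (a ^ j / j.factorial)) •
    gammaMeasure ((n + j : ℕ) : ℝ) 1

lemma aux_hasSum (a : ℝ) : HasSum (fun j : ℕ => Real.exp (-a) * (a ^ j / j.factorial)) 1 := by
  have h := (NormedSpace.expSeries_div_hasSum_exp a).mul_left (Real.exp (-a))
  rwa [← Real.exp_eq_exp_ℝ, ← Real.exp_add, neg_add_cancel, Real.exp_zero] at h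

lemma mix_prob (n : ℕ) (hn : 1 ≤ n) (a : ℝ) (ha : 0 ≤ a) :
    IsProbabilityMeasure (mixMeasure n a) := by
  constructor
  have hg : ∀ j : ℕ, IsProbabilityMeasure (gammaMeasure ((n + j : ℕ) : ℝ) 1) := fun j =>
    isProbabilityMeasure_gammaMeasure (by have : 0 < n + j := by omega
                                          exact_mod_cast this) one_pos
  rw [mixMeasure, Measure.sum_apply _ MeasurableSet.univ]
  simp only [Measure.smul_apply, measure_univ, smul_eq_mul, mul_one]
  rw [← ENNReal.ofReal_tsum_of_nonneg (fun j => by positivity) (aux_hasSum a).summable,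
    (aux_hasSum a).tsum_eq, ENNReal.ofReal_one]

lemma mix_char (n : ℕ) (hn : 1 ≤ n) (a : ℝ) (ha : 0 ≤ a) (t : ℝ) :
    charFun (mixMeasure n a) t = ((1 - t * Complex.I)⁻¹) ^ n *
      Complex.exp (a * ((1 - t * Complex.I)⁻¹ - 1)) := by
  have := mix_prob n hn a ha
  have hint : Integrable (fun x : ℝ => Complex.exp (t * x * Complex.I)) (mixMeasure n a) := by
    refine Integrable.of_bound (C := 1) (by fun_prop) (ae_of_all _ fun x => ?_)
    simp [Complex.norm_exp]
  rw [charFun_apply_real]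
  have h1 := hasSum_integral_measure hint
  refine h1.unique ?_
  set w := (1 - t * Complex.I)⁻¹
  have h2 := (NormedSpace.expSeries_div_hasSum_exp (a * w)).mul_left (w ^ n * Complex.exp (-a))
  rw [← Complex.exp_eq_exp_ℂ] at h2
  convert! h2 using 1
  · ext j
    rw [integral_smul_measure, ← charFun_apply_real, aux_charGamma _ (by omega),
      ENNReal.toReal_ofReal (by positivity), Complex.real_smul]
    push_cast
    rw [mul_pow, pow_add]; ring
  · rw [mul_assoc, ← Complex.exp_add]; congr 2; ring

lemma gamma_Ioi (n : ℕ) (hn : 1 ≤ n) (x : ℝ) (hx : 0 ≤ x) :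
    (gammaMeasure (n : ℝ) 1).real (Iic x) =
      (∫ t in (0:ℝ)..x, t ^ (n - 1) * Real.exp (-t)) / Real.Gamma n := by
  have hn0 : (0:ℝ) < n := by exact_mod_cast hn
  have := isProbabilityMeasure_gammaMeasure hn0 one_pos
  rw [← cdf_eq_real, cdf_gammaMeasure_eq_integral hn0 one_pos, intervalIntegral.integral_of_le hx,
    ← integral_Icc_eq_integral_Ioc, div_eq_inv_mul, ← integral_const_mul,
    ← integral_indicator measurableSet_Iic, ← integral_indicator measurableSet_Icc]
  congr 1
  ext t
  by_cases ht : t ∈ Icc 0 x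
  · rw [indicator_of_mem ht, indicator_of_mem (by exact ht.2), gammaPDFReal, if_pos ht.1,
      Real.one_rpow, ← Real.rpow_natCast, Nat.cast_sub hn]
    simp; ring
  · rw [indicator_of_notMem ht]
    by_cases ht' : t ∈ Iic x
    · rw [indicator_of_mem ht', gammaPDFReal, if_neg]
      exact fun h => ht ⟨h, ht'⟩
    · rw [indicator_of_notMem ht']

lemma map_eq (n : ℕ) (hn : 1 ≤ n) (σ : ℝ) (hσ : 0 < σ)
    (μ : Fin (2 * n) → ℝ) :
    (Measure.pi fun i : Fin (2 * n) => gaussianReal (μ i) ((σ ^ 2 / 2).toNNReal)).map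
      (fun x => ∑ i, (x i) ^ 2 / σ ^ 2) = mixMeasure n ((∑ i, (μ i) ^ 2) / σ ^ 2) := by
  have := mix_prob n hn ((∑ i, (μ i) ^ 2) / σ ^ 2) (by positivity)
  have hmeas : Measurable (fun x : Fin (2 * n) → ℝ => ∑ i, (x i) ^ 2 / σ ^ 2) := by fun_prop
  have : IsProbabilityMeasure ((Measure.pi fun i : Fin (2 * n) => gaussianReal (μ i) ((σ ^ 2 / 2).toNNReal)).map
      (fun x => ∑ i, (x i) ^ 2 / σ ^ 2)) := Measure.isProbabilityMeasure_map hmeas.aemeasurable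
  apply Measure.ext_of_charFun
  ext t
  rw [mix_char n hn _ (by positivity), charFun_apply_real, integral_map hmeas.aemeasurable (by fun_prop)]
  obtain ⟨A, hA, h⟩ := aux_charGauss σ hσ t
  have e : ∀ x : Fin (2 * n) → ℝ, Complex.exp (t * (∑ i, (x i) ^ 2 / σ ^ 2 : ℝ) * Complex.I) =
      ∏ i, Complex.exp (t * ((x i)^2/σ^2 : ℝ) * Complex.I) := by
    intro x
    rw [← Complex.exp_sum, Complex.ofReal_sum, Finset.mul_sum, Finset.sum_mul]
  simp_rw [e]
  rw [integral_fintype_prod_eq_prod (f := fun i y => Complex.exp (t * (y^2/σ^2 : ℝ) * Complex.I))]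
  simp_rw [h]
  rw [Finset.prod_mul_distrib, Finset.prod_const, ← Complex.exp_sum, ← Finset.sum_mul,
    ← Complex.ofReal_sum, Finset.sum_div, ← hA, ← pow_mul]
  simp

/-- The noncentral chi-square tail series: the general-case successful
detection probability `P_G^(D)` of equation (18) of the paper. -/
theorem stmt_7 (n : ℕ) (hn : 1 ≤ n) (σ : ℝ) (hσ : 0 < σ)
    (μ : Fin (2 * n) → ℝ) (E : ℝ) (hE : 0 ≤ E) (m : ℝ)
    (hm : m = ∑ i, (μ i) ^ 2) :
    (Measure.pi fun i : Fin (2 * n) => gaussianReal (μ i) ((σ ^ 2 / 2).toNNReal))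
        {x | E < ∑ i, (x i) ^ 2} =
      ENNReal.ofReal (1 - Real.exp (-(m / σ ^ 2)) *
        ∑' j : ℕ, ((m / σ ^ 2) ^ j / (Nat.factorial j)) *
          (∫ t in (0:ℝ)..(E / σ ^ 2), t ^ (n + j - 1) * Real.exp (-t)) /
            Real.Gamma (n + j)) := by
  have hs : 0 < σ ^ 2 := by positivity
  have hmeas : Measurable (fun x : Fin (2 * n) → ℝ => ∑ i, (x i) ^ 2 / σ ^ 2) := by fun_prop
  have hset : {x : Fin (2 * n) → ℝ | E < ∑ i, (x i) ^ 2} =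
      (fun x : Fin (2 * n) → ℝ => ∑ i, (x i) ^ 2 / σ ^ 2) ⁻¹' (Iic (E / σ^2))ᶜ := by
    ext x
    simp only [mem_ofPred_eq, mem_preimage, mem_compl_iff, mem_Iic, not_le, ← Finset.sum_div]
    rw [div_lt_div_iff_of_pos_right hs]
  have hm0 : 0 ≤ m / σ ^ 2 := by rw [hm]; positivity
  have := mix_prob n hn (m / σ ^ 2) hm0
  rw [hset, ← Measure.map_apply hmeas measurableSet_Iic.compl, map_eq n hn σ hσ μ, ← hm,
    ← ofReal_measureReal, probReal_compl_eq_one_sub measurableSet_Iic]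
  congr 2
  rw [measureReal_def, mixMeasure, Measure.sum_apply _ measurableSet_Iic, ENNReal.tsum_toReal_eq,
    ← tsum_mul_left]
  · refine tsum_congr fun j => ?_
    have := gamma_Ioi (n + j) (by omega) (E / σ^2) (by positivity)
    rw [measureReal_def] at this
    rw [Measure.smul_apply, smul_eq_mul, ENNReal.toReal_mul, this,
      ENNReal.toReal_ofReal (by positivity)]
    push_cast
    ring
  · intro j
    have : IsProbabilityMeasure (gammaMeasure ((n + j : ℕ) : ℝ) 1) :=
      isProbabilityMeasure_gammaMeasure (by have : 0 < n + j := by omega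
                                            exact_mod_cast this) one_pos
    exact ENNReal.mul_ne_top ENNReal.ofReal_ne_top (measure_ne_top _ _)
end

section
/- Let n ≥ 1 be a natural number, σ > 0, and h : Fin n → ℝ; set m := (Σᵢ hᵢ²)/σ². Then the pushforward of the product measure ⨂_{i ∈ Fin n} gaussianReal (hᵢ) (σ²/2) under the map x ↦ (2·Σᵢ hᵢ·xᵢ − Σᵢ hᵢ²)/σ² is gaussianReal m (2m), while the pushforward of ⨂_{i ∈ Fin n} gaussianReal 0 (σ²/2) under the same map is gaussianReal (−m) (2m). -/
open MeasureTheory ProbabilityTheory BigOperators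

/-- Law of a linear combination of independent real Gaussians. -/
lemma map_linear_pi_gaussian (n : ℕ) (h μ : Fin n → ℝ) (v : NNReal) :
    Measure.map (fun x : Fin n → ℝ => ∑ i, h i * x i)
      (Measure.pi fun i : Fin n => gaussianReal (μ i) v) =
    gaussianReal (∑ i, h i * μ i) ((∑ i, (h i) ^ 2) * v).toNNReal := by
  have h1 : Measure.map (fun x : Fin n → ℝ => ∑ i, h i * x i)
      (Measure.pi fun i : Fin n => gaussianReal (μ i) v) =
      Measure.map (fun x : Fin n → ℝ => ∑ i, x i) (Measure.pi fun i : Fin n =>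
        (gaussianReal (μ i) v).map (fun x => h i * x)) := by
    rw [← Measure.pi_map_pi (fun i => by fun_prop),
      Measure.map_map (by fun_prop) (by fun_prop)]
    rfl
  rw [h1]
  simp_rw [gaussianReal_map_const_mul]
  apply Measure.ext_of_charFun
  rw [charFun_map_sum_pi_eq_prod]
  ext t
  have hs : (0 : ℝ) ≤ (∑ i, (h i) ^ 2) * v := by positivity
  simp only [Finset.prod_apply, charFun_gaussianReal, Real.coe_toNNReal _ hs]
  rw [← Complex.exp_sum]
  congr 1
  push_cast
  rw [Finset.sum_sub_distrib, Finset.mul_sum, Finset.sum_mul, Finset.sum_mul, Finset.sum_mul,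
    Finset.sum_div]

lemma map_affine_pi_gaussian (n : ℕ) (σ : ℝ) (hσ : 0 < σ) (h μ : Fin n → ℝ) :
    Measure.map
        (fun x : Fin n → ℝ => (2 * (∑ i, h i * x i) - ∑ i, (h i) ^ 2) / σ ^ 2)
        (Measure.pi fun i : Fin n => gaussianReal (μ i) ((σ ^ 2 / 2).toNNReal)) =
      gaussianReal ((2 * (∑ i, h i * μ i) - ∑ i, (h i) ^ 2) / σ ^ 2)
        ((2 * ((∑ i, (h i) ^ 2) / σ ^ 2)).toNNReal) := by
  have h1 : (fun x : Fin n → ℝ => (2 * (∑ i, h i * x i) - ∑ i, (h i) ^ 2) / σ ^ 2) =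
    (fun y : ℝ => y / σ ^ 2) ∘ (fun y : ℝ => y - ∑ i, (h i) ^ 2) ∘ (fun y : ℝ => 2 * y) ∘
      (fun x : Fin n → ℝ => ∑ i, h i * x i) := rfl
  rw [h1, ← Measure.map_map (by fun_prop) (by fun_prop),
    ← Measure.map_map (by fun_prop) (by fun_prop),
    ← Measure.map_map (by fun_prop) (by fun_prop), map_linear_pi_gaussian,
    gaussianReal_map_const_mul, gaussianReal_map_sub_const, gaussianReal_map_div_const]
  congr 1
  apply NNReal.eq
  have h2 : (0 : ℝ) ≤ σ ^ 2 / 2 := by positivity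
  have h3 : (0 : ℝ) ≤ (∑ i, (h i) ^ 2) * (σ ^ 2 / 2) := by positivity
  have h4 : (0 : ℝ) ≤ 2 * ((∑ i, (h i) ^ 2) / σ ^ 2) := by positivity
  simp only [NNReal.coe_div, NNReal.coe_mul, NNReal.coe_mk, Real.coe_toNNReal _ h2,
    Real.coe_toNNReal _ h3, Real.coe_toNNReal _ h4]
  field_simp
  try norm_num

/-- Distribution of the log-likelihood ratio statistic of Section IV-A-2 of
the paper: `N(m, 2m)` under the alternative and `N(-m, 2m)` under the null. -/
theorem stmt_8 (n : ℕ) (hn : 1 ≤ n) (σ : ℝ) (hσ : 0 < σ) (h : Fin n → ℝ)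
    (m : ℝ) (hm : m = (∑ i, (h i) ^ 2) / σ ^ 2) :
    Measure.map
        (fun x : Fin n → ℝ => (2 * (∑ i, h i * x i) - ∑ i, (h i) ^ 2) / σ ^ 2)
        (Measure.pi fun i : Fin n => gaussianReal (h i) ((σ ^ 2 / 2).toNNReal)) =
      gaussianReal m ((2 * m).toNNReal) ∧
    Measure.map
        (fun x : Fin n → ℝ => (2 * (∑ i, h i * x i) - ∑ i, (h i) ^ 2) / σ ^ 2)
        (Measure.pi fun _ : Fin n => gaussianReal 0 ((σ ^ 2 / 2).toNNReal)) =
      gaussianReal (-m) ((2 * m).toNNReal) := by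
  subst hm
  constructor
  · rw [map_affine_pi_gaussian n σ hσ h h]
    congr 2
    simp only [← pow_two]
    ring
  · rw [map_affine_pi_gaussian n σ hσ h (fun _ => 0)]
    congr 1
    simp [neg_div]
end

section
/- Let n ≥ 1 be a natural number and c > 0. The function g : [0, ∞) → ℝ defined by g(x) := exp(−x) · Σ_{j=0}^∞ ( x^j / j! ) · ( ∫_0^c t^{n+j−1}·exp(−t) dt ) / Γ(n + j) is strictly decreasing on [0, ∞). -/
open Real BigOperators

lemma aux_summable (a : ℕ → ℝ) (ha : StrictAnti a) (h0 : ∀ j, 0 ≤ a j) (x : ℝ) (hx : 0 ≤ x) :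
    Summable (fun j : ℕ => x ^ j / (Nat.factorial j) * a j) := by
  refine Summable.of_nonneg_of_le (fun j => mul_nonneg (by positivity) (h0 j)) (fun j => ?_)
    ((Real.summable_pow_div_factorial x).mul_right (a 0))
  exact mul_le_mul_of_nonneg_left (ha.antitone (Nat.zero_le j)) (by positivity)

lemma aux_binom (x d : ℝ) (k : ℕ) :
    (x + d) ^ k / (Nat.factorial k) = ∑ p ∈ Finset.HasAntidiagonal.antidiagonal k,
      d ^ p.1 / (Nat.factorial p.1) * (x ^ p.2 / (Nat.factorial p.2)) := by
  rw [add_comm x d, (Commute.all d x).add_pow', Finset.sum_div]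
  refine Finset.sum_congr rfl fun p hp => ?_
  rw [Finset.HasAntidiagonal.mem_antidiagonal] at hp
  have h := Nat.add_choose_mul_factorial_mul_factorial p.1 p.2
  rw [hp, ← Nat.choose_symm_of_eq_add hp.symm] at h
  have h' : ((k.choose p.1 : ℕ) : ℝ) * (Nat.factorial p.1) * (Nat.factorial p.2)
      = (Nat.factorial k) := by exact_mod_cast h
  have h1 : ((Nat.factorial p.1 : ℕ) : ℝ) ≠ 0 := by positivity
  have h2 : ((Nat.factorial p.2 : ℕ) : ℝ) ≠ 0 := by positivity
  have h3 : ((Nat.factorial k : ℕ) : ℝ) ≠ 0 := by positivity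
  rw [nsmul_eq_mul]
  field_simp
  rw [← h']
  ring

lemma aux_anti (a : ℕ → ℝ) (ha : StrictAnti a) (h0 : ∀ j, 0 ≤ a j) :
    StrictAntiOn (fun x : ℝ => Real.exp (-x) * ∑' j : ℕ, x ^ j / (Nat.factorial j) * a j)
      (Set.Ici 0) := by
  intro x hx y hy hxy
  simp only [Set.mem_Ici] at hx hy
  obtain ⟨d, hd, rfl⟩ : ∃ d, 0 < d ∧ y = x + d := ⟨y - x, by linarith, by ring⟩
  have hsx := aux_summable a ha h0 x hx
  have hsy := aux_summable a ha h0 (x + d) hy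
  have hsd := Real.summable_pow_div_factorial d
  have hE : Real.exp d = ∑' j : ℕ, d ^ j / (Nat.factorial j) := by
    rw [Real.exp_eq_exp_ℝ, NormedSpace.exp_eq_tsum_div]
  have key : ∑' j : ℕ, (x + d) ^ j / (Nat.factorial j) * a j <
      Real.exp d * ∑' j : ℕ, x ^ j / (Nat.factorial j) * a j := by
    rw [hE, tsum_mul_tsum_eq_tsum_sum_antidiagonal_of_summable_norm hsd.norm hsx.norm]
    have hs := (summable_norm_sum_mul_antidiagonal_of_summable_norm hsd.norm hsx.norm).of_norm
    refine Summable.tsum_lt_tsum (i := 1) (fun k => ?_) ?_ hsy hs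
    · simp only []
      rw [aux_binom, Finset.sum_mul]
      refine Finset.sum_le_sum fun p hp => ?_
      rw [mul_assoc]
      rw [Finset.HasAntidiagonal.mem_antidiagonal] at hp
      have : a k ≤ a p.2 := ha.antitone (by omega)
      gcongr
    · have h1 : a 1 < a 0 := ha (by norm_num)
      simp [Finset.Nat.antidiagonal_succ]
      nlinarith
  calc Real.exp (-(x + d)) * ∑' j : ℕ, (x + d) ^ j / (Nat.factorial j) * a j
      < Real.exp (-(x + d)) * (Real.exp d * ∑' j : ℕ, x ^ j / (Nat.factorial j) * a j) :=
        mul_lt_mul_of_pos_left key (Real.exp_pos _)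
    _ = _ := by
        rw [← mul_assoc, ← Real.exp_add]
        congr 2
        ring

lemma aux_rec (m : ℕ) (c : ℝ) :
    (∫ t in (0:ℝ)..c, t ^ (m + 1) * Real.exp (-t)) =
      (m + 1) * (∫ t in (0:ℝ)..c, t ^ m * Real.exp (-t)) - c ^ (m + 1) * Real.exp (-c) := by
  have h : ∀ t ∈ Set.uIcc 0 c, HasDerivAt (fun t : ℝ => t ^ (m + 1) * Real.exp (-t))
      ((m + 1) * (t ^ m * Real.exp (-t)) - t ^ (m + 1) * Real.exp (-t)) t := by
    intro t _
    have := (hasDerivAt_pow (m + 1) t).mul ((hasDerivAt_neg t).exp)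
    refine this.congr_deriv ?_
    push_cast
    simp
    ring
  have i1 : IntervalIntegrable (fun t : ℝ => ((m : ℝ) + 1) * (t ^ m * Real.exp (-t)))
      MeasureTheory.volume 0 c := Continuous.intervalIntegrable (by fun_prop) _ _
  have i2 : IntervalIntegrable (fun t : ℝ => t ^ (m + 1) * Real.exp (-t))
      MeasureTheory.volume 0 c := Continuous.intervalIntegrable (by fun_prop) _ _
  have := intervalIntegral.integral_eq_sub_of_hasDerivAt h (i1.sub i2)
  rw [intervalIntegral.integral_sub i1 i2, intervalIntegral.integral_const_mul] at this
  simp at this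
  linarith

/-- Monotonicity claim of Section IV-B of the paper: the complement of the
general-case detection probability, as a function of the noncentrality
parameter, is strictly decreasing on `[0, ∞)`. -/
theorem stmt_11 (n : ℕ) (hn : 1 ≤ n) (c : ℝ) (hc : 0 < c) :
    StrictAntiOn
      (fun x : ℝ => Real.exp (-x) *
        ∑' j : ℕ, (x ^ j / (Nat.factorial j)) *
          (∫ t in (0:ℝ)..c, t ^ (n + j - 1) * Real.exp (-t)) /
            Real.Gamma (n + j))
      (Set.Ici 0) := by
  obtain ⟨k, rfl⟩ : ∃ k, n = k + 1 := ⟨n - 1, by omega⟩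
  have hG : ∀ j : ℕ, Real.Gamma (((k + 1 : ℕ) : ℝ) + j) = (Nat.factorial (k + j)) := by
    intro j
    rw [← Real.Gamma_nat_eq_factorial]
    congr 1
    push_cast
    ring
  have hI : ∀ j : ℕ, k + 1 + j - 1 = k + j := fun j => by omega
  simp only [hG, hI, mul_div_assoc]
  refine aux_anti (fun j => (∫ t in (0:ℝ)..c, t ^ (k + j) * Real.exp (-t)) /
    (Nat.factorial (k + j))) (strictAnti_nat_of_succ_lt fun j => ?_) (fun j => ?_)
  · rw [← add_assoc, aux_rec, Nat.factorial_succ]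
    have h1 : (0:ℝ) < (Nat.factorial (k + j) : ℕ) := by positivity
    have h2 : 0 < c ^ (k + j + 1) * Real.exp (-c) := by positivity
    rw [div_lt_div_iff₀ (by positivity) h1]
    push_cast
    nlinarith
  · refine div_nonneg (intervalIntegral.integral_nonneg hc.le fun t ht => ?_) (by positivity)
    have := ht.1
    positivity
end

section
/- Let K ≥ 1, let T be a K×K Hermitian positive semidefinite complex matrix, let Y be a K×K Hermitian positive definite complex matrix, let μ ∈ ℂ^K, a ≥ 0, and ρ > 0. For ζ ≥ 0 let H(ζ) := (a + ζ)·T + (ρ/2)·Y (which is positive definite, hence invertible) and define φ(ζ) := Re( (H(ζ)⁻¹μ)ᴴ · T · (H(ζ)⁻¹μ) ). Then φ is antitone (nonincreasing) on [0, ∞) and convex on [0, ∞). -/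
open Matrix
open scoped ComplexOrder

/-- Nonnegativity of the mixed term, for ordered parameters. -/
theorem aux_mixed {V : Type*} (b c : V → V → ℝ)
    (bs : ∀ x y, b x y = b y x) (cs : ∀ x y, c x y = c y x)
    (b0 : ∀ x, 0 ≤ b x x) (c0 : ∀ x, 0 ≤ c x x)
    (sol : ∀ s : ℝ, 0 ≤ s → ∀ z, ∃ w, ∀ u, s * b u w + c u w = b u z)
    (s t : ℝ) (hs : 0 ≤ s) (hst : s ≤ t) (x w v : V)
    (hw : ∀ u, s * b u w + c u w = b u x) (hv : ∀ u, t * b u v + c u v = b u x) :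
    0 ≤ b v w := by
  obtain ⟨r, hr⟩ := sol s hs v
  have e1 := hr w
  have e2 := hw r
  have e3 := hv r
  have e4 := hr v
  have e5 := hr r
  rw [bs w r, cs w r] at e1
  rw [bs v r, cs v r] at e4
  have h1 : 0 ≤ b r v := by
    rw [← e5]; exact add_nonneg (mul_nonneg hs (b0 r)) (c0 r)
  have h2 : b v w = b v v + (t - s) * b r v := by
    rw [bs v w]; linarith
  rw [h2]
  exact add_nonneg (b0 v) (mul_nonneg (sub_nonneg.2 hst) h1)

/-- Supporting line inequality. -/
theorem aux_tangent {V : Type*} (b c : V → V → ℝ) (m : V → ℝ)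
    (bs : ∀ x y, b x y = b y x) (cs : ∀ x y, c x y = c y x)
    (b0 : ∀ x, 0 ≤ b x x) (c0 : ∀ x, 0 ≤ c x x)
    (bq : ∀ x y, 0 ≤ b x x - 2 * b x y + b y y)
    (sol : ∀ s : ℝ, 0 ≤ s → ∀ z, ∃ w, ∀ u, s * b u w + c u w = b u z)
    (s : ℝ) (hs : 0 ≤ s) (x : V) (hx : ∀ u, s * b u x + c u x = m u) :
    ∃ g : ℝ, 0 ≤ g ∧ ∀ t : ℝ, 0 ≤ t → ∀ y, (∀ u, t * b u y + c u y = m u) →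
      b x x - g * (t - s) ≤ b y y := by
  obtain ⟨w, hw⟩ := sol s hs x
  refine ⟨2 * b w x, ?_, ?_⟩
  · rw [← hw w]
    exact mul_nonneg (by norm_num) (add_nonneg (mul_nonneg hs (b0 w)) (c0 w))
  intro t ht y hy
  obtain ⟨v, hv⟩ := sol t ht x
  have hm : 0 ≤ b v w := by
    rcases le_total s t with h | h
    · exact aux_mixed b c bs cs b0 c0 sol s t hs h x w v hw hv
    · rw [bs]; exact aux_mixed b c bs cs b0 c0 sol t s ht h x v w hv hw
  have e1 := hv y
  have e2 := hv x
  have e3 := hy v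
  have e4 := hx v
  rw [bs y v, cs y v, bs y x] at e1
  have e5 := hw v
  have e6 := hv w
  rw [bs w v, cs w v] at e6
  rw [bs x v, cs x v] at e2
  have k1 : b x y - b x x = -(t - s) * b v x := by linarith
  have k2 : b w x - b v x = (t - s) * b v w := by linarith
  have k3 := bq x y
  have k4 := mul_nonneg (mul_self_nonneg (t - s)) hm
  have k5 : (t - s) * (b w x - b v x) = (t - s) * (t - s) * b v w := by rw [k2]; ring
  nlinarith

theorem aux_symm {K : ℕ} {M : Matrix (Fin K) (Fin K) ℂ} (hM : M.IsHermitian)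
    (x y : Fin K → ℂ) : (star x ⬝ᵥ M.mulVec y).re = (star y ⬝ᵥ M.mulVec x).re := by
  have : star (star x ⬝ᵥ M.mulVec y) = star y ⬝ᵥ M.mulVec x := by
    rw [star_dotProduct, star_star, star_mulVec, hM.eq, ← dotProduct_mulVec]
  rw [← this]; simp

/-- Section V-A of the paper: the function `ζ ↦ ν(ζ)ᴴ T ν(ζ)` with
`ν(ζ) = ((a + ζ)T + (ρ/2)Y)⁻¹ μ` is nonincreasing and convex on `[0, ∞)`. -/
theorem stmt_13 (K : ℕ) (hK : 1 ≤ K) (T Y : Matrix (Fin K) (Fin K) ℂ)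
    (hT : T.PosSemidef) (hY : Y.PosDef) (μ : Fin K → ℂ) (a ρ : ℝ)
    (ha : 0 ≤ a) (hρ : 0 < ρ) (φ : ℝ → ℝ)
    (hφ : ∀ ζ : ℝ, φ ζ =
      (star ((((a + ζ : ℝ) : ℂ) • T + ((ρ / 2 : ℝ) : ℂ) • Y)⁻¹.mulVec μ) ⬝ᵥ
        T.mulVec ((((a + ζ : ℝ) : ℂ) • T + ((ρ / 2 : ℝ) : ℂ) • Y)⁻¹.mulVec μ)).re) :
    AntitoneOn φ (Set.Ici 0) ∧ ConvexOn ℝ (Set.Ici 0) φ := by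
  have hS : (((ρ / 2 : ℝ) : ℂ) • Y).PosDef :=
    hY.smul (by exact_mod_cast half_pos hρ)
  generalize ((ρ / 2 : ℝ) : ℂ) • Y = S at hS hφ
  have hH : ∀ s : ℝ, 0 ≤ s → ((s : ℂ) • T + S).PosDef := fun s hs =>
    Matrix.PosDef.posSemidef_add (hT.smul (by exact_mod_cast hs)) hS
  let b : (Fin K → ℂ) → (Fin K → ℂ) → ℝ := fun x y => (star x ⬝ᵥ T.mulVec y).re
  let c : (Fin K → ℂ) → (Fin K → ℂ) → ℝ := fun x y => (star x ⬝ᵥ S.mulVec y).re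
  have bs : ∀ x y, b x y = b y x := aux_symm hT.isHermitian
  have cs : ∀ x y, c x y = c y x := aux_symm hS.isHermitian
  have b0 : ∀ x, 0 ≤ b x x := fun x => hT.re_dotProduct_nonneg x
  have c0 : ∀ x, 0 ≤ c x x := fun x => hS.posSemidef.re_dotProduct_nonneg x
  have bq : ∀ x y, 0 ≤ b x x - 2 * b x y + b y y := by
    intro x y
    have h := b0 (x - y)
    have h2 : b (x - y) (x - y) = b x x - b x y - b y x + b y y := by
      simp only [b, star_sub, mulVec_sub, sub_dotProduct, dotProduct_sub, Complex.sub_re]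
      ring
    rw [h2, bs y x] at h
    linarith
  have inv : ∀ s : ℝ, 0 ≤ s → ∀ z u : Fin K → ℂ,
      s * b u (((s : ℂ) • T + S)⁻¹.mulVec z) + c u (((s : ℂ) • T + S)⁻¹.mulVec z)
        = (star u ⬝ᵥ z).re := by
    intro s hs z u
    have h1 : ((s : ℂ) • T + S).mulVec (((s : ℂ) • T + S)⁻¹.mulVec z) = z := by
      rw [mulVec_mulVec, Matrix.mul_nonsing_inv _
        ((Matrix.isUnit_iff_isUnit_det _).1 (hH s hs).isUnit), one_mulVec]
    conv_rhs => rw [← h1]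
    generalize ((s : ℂ) • T + S)⁻¹.mulVec z = w
    simp [b, c, add_mulVec, smul_mulVec, dotProduct_add, dotProduct_smul]
  have key : ∀ s ∈ Set.Ici (0 : ℝ), ∃ g : ℝ, 0 ≤ g ∧ ∀ t ∈ Set.Ici (0 : ℝ),
      φ s - g * (t - s) ≤ φ t := by
    intro s hs
    have hs' : 0 ≤ a + s := add_nonneg ha hs
    obtain ⟨g, hg, h⟩ := aux_tangent b c (fun u => (star u ⬝ᵥ μ).re) bs cs b0 c0 bq
      (fun s hs z => ⟨_, inv s hs (T.mulVec z)⟩) (a + s) hs' _ (inv (a + s) hs' μ)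
    refine ⟨g, hg, fun t ht => ?_⟩
    have ht' : 0 ≤ a + t := add_nonneg ha ht
    have := h (a + t) ht' _ (inv (a + t) ht' μ)
    rw [hφ s, hφ t]
    rw [add_sub_add_left_eq_sub] at this
    exact this
  refine ⟨?_, convex_Ici 0, ?_⟩
  · intro s hs t ht hst
    obtain ⟨g, hg, h⟩ := key t ht
    have := h s hs
    nlinarith [mul_nonneg hg (sub_nonneg.2 hst)]
  · intro x hx y hy p q hp hq hpq
    obtain ⟨g, hg, h⟩ := key (p • x + q • y) (convex_Ici 0 hx hy hp hq hpq)
    have h1 := mul_le_mul_of_nonneg_left (h x hx) hp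
    have h2 := mul_le_mul_of_nonneg_left (h y hy) hq
    simp only [smul_eq_mul] at *
    generalize φ (p * x + q * y) = f at *
    obtain rfl : q = 1 - p := by linarith
    nlinarith
end
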